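/- arXiv:2407.11434 — 16 statements merged into one kernel-verified Lean document; each statement's English description precedes it below -/
import Mathlib

section
/- Let (S,·,∘) be a generalized regular ∘-semigroup and define x⁺ = x·x∘ and x* = x∘·x for all x ∈ S. Then (S,·,⁺,*) is a DRC-restriction semigroup, and moreover x* = (x∘)⁺ and x⁺ = (x∘)* for all x ∈ S. -/
/-- If `(S, ·, ∘)` is a generalized regular ∘-semigroup and `x⁺ = x * x∘`,
`x* = x∘ * x`, then `(S, ·, ⁺, *)` is a DRC-restriction semigroup, and moreover
`x* = (x∘)⁺` and `x⁺ = (x∘)*` for all `x`. -/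
theorem stmt_0 (S : Type*) [Semigroup S] (c : S → S)
    (hc1 : ∀ x : S, x * c x * x = x)
    (hc2 : ∀ x : S, c (c x) = x)
    (hc3 : ∀ x y : S, c (x * y) = c (x * y) * x * c x)
    (hc4 : ∀ x y : S, c (x * y) = c y * y * c (x * y))
    (hc5 : ∀ x y : S, c (x * y) * x = c (c x * x * y))
    (p s : S → S)
    (hp : ∀ x : S, p x = x * c x)
    (hs : ∀ x : S, s x = c x * x) :
    ((∀ x : S, p x * x = x) ∧
     (∀ x y : S, p (x * y) = p (x * p y)) ∧
     (∀ x y : S, p (x * y) = p x * p (x * y) * p x) ∧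
     (∀ x : S, p (p x) = p x) ∧
     (∀ x : S, s (p x) = p x) ∧
     (∀ x : S, x * s x = x) ∧
     (∀ x y : S, s (x * y) = s (s x * y)) ∧
     (∀ x y : S, s (x * y) = s y * s (x * y) * s y) ∧
     (∀ x : S, s (s x) = s x) ∧
     (∀ x : S, p (s x) = s x) ∧
     (∀ x y : S, x * s (y * x) = s (y * p x) * x) ∧
     (∀ x y : S, p (x * y) * x = x * p (s x * y))) ∧
    (∀ x : S, s x = p (c x)) ∧ (∀ x : S, p x = s (c x)) := by
  have hc1' : ∀ x : S, c x * x * c x = c x := fun x => by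
    simpa only [hc2] using hc1 (c x)
  have hc5' : ∀ x y : S, y * c (x * y) = c (x * (y * c y)) := fun x y => by
    have h := hc5 (c y) (y * c (x * y))
    rw [hc2, ← mul_assoc (c y), ← hc4, hc2, ← mul_assoc (y * c y), hc1] at h
    rw [← mul_assoc x, h, hc2]
  have c_proj : ∀ x : S, c (x * c x) = x * c x := fun x => by
    have h := hc5 x (c x)
    rw [hc1', hc2] at h
    rw [hc3, h]
  have c_proj' : ∀ x : S, c (c x * x) = c x * x := fun x => by
    simpa only [hc2] using c_proj (c x)
  have absorb : ∀ x y : S, x * (c x * (x * y)) = x * y := fun x y => by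
    rw [← mul_assoc, ← mul_assoc, hc1]
  have idem : ∀ x : S, x * c x * (x * c x) = x * c x := fun x => by
    rw [← mul_assoc, hc1]
  have idem' : ∀ x : S, c x * x * (c x * x) = c x * x := fun x => by
    rw [← mul_assoc, hc1']
  simp only [hp, hs]
  refine ⟨⟨hc1, fun x y => ?_, fun x y => ?_, fun x => ?_, fun x => ?_, fun x => ?_,
    fun x y => ?_, fun x y => ?_, fun x => ?_, fun x => ?_, fun x y => ?_, fun x y => ?_⟩,
    fun x => ?_, fun x => ?_⟩
  · rw [← hc5']
    simp only [mul_assoc, absorb]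
  · conv_lhs => rw [hc3]
    simp only [mul_assoc, absorb]
  · rw [c_proj, idem]
  · rw [c_proj, idem]
  · rw [← mul_assoc, hc1]
  · rw [← hc5]
    simp only [mul_assoc, absorb]
  · conv_lhs => rw [hc4]
    have h : ∀ z : S, z * y * (c y * y) = z * y := fun z => by
      rw [mul_assoc, ← mul_assoc y, hc1]
    rw [mul_assoc (c y * y), ← mul_assoc (c (x * y)) x y, mul_assoc (c y * y), h]
  · rw [c_proj', idem']
  · rw [c_proj', idem']
  · rw [← hc5']
    simp only [mul_assoc]
    rw [← mul_assoc x (c x) x, hc1]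
  · rw [← hc5]
    simp only [mul_assoc, absorb]
  · rw [hc2]
  · rw [hc2]
end

section
/- Let (S,·,⁺,*) be a DRC-restriction semigroup and suppose that for each x ∈ S there exists an element x∘ ∈ S with x⁺ = x·x∘, x* = x∘·x, x* = (x∘)⁺ and x⁺ = (x∘)*. Then for each x this element x∘ is unique (i.e. if y ∈ S satisfies x⁺ = xy, x* = yx, x* = y⁺ and x⁺ = y*, then y = x∘), and the unary operation x ↦ x∘ makes (S,·,∘) a generalized regular ∘-semigroup: x·x∘·x = x, (x∘)∘ = x, (xy)∘ = (xy)∘·x·x∘, (xy)∘ = y∘·y·(xy)∘, and (xy)∘·x = (x∘·x·y)∘ for all x,y ∈ S. -/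
/-- If `(S, ·, ⁺, *)` is a DRC-restriction semigroup and each `x ∈ S` has an
element `x∘` with `x⁺ = x·x∘`, `x* = x∘·x`, `x* = (x∘)⁺`, `x⁺ = (x∘)*`, then
such `x∘` is unique and `x ↦ x∘` makes `S` a generalized regular ∘-semigroup. -/
theorem stmt_1 (S : Type*) [Semigroup S] (p s : S → S)
    (h1 : ∀ x : S, p x * x = x)
    (h2 : ∀ x y : S, p (x * y) = p (x * p y))
    (h3 : ∀ x y : S, p (x * y) = p x * p (x * y) * p x)
    (h4 : ∀ x : S, p (p x) = p x)
    (h5 : ∀ x : S, s (p x) = p x)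
    (h1' : ∀ x : S, x * s x = x)
    (h2' : ∀ x y : S, s (x * y) = s (s x * y))
    (h3' : ∀ x y : S, s (x * y) = s y * s (x * y) * s y)
    (h4' : ∀ x : S, s (s x) = s x)
    (h5' : ∀ x : S, p (s x) = s x)
    (h6 : ∀ x y : S, x * s (y * x) = s (y * p x) * x)
    (h6' : ∀ x y : S, p (x * y) * x = x * p (s x * y))
    (c : S → S)
    (hc : ∀ x : S, p x = x * c x ∧ s x = c x * x ∧ s x = p (c x) ∧ p x = s (c x)) :
    (∀ x y : S, p x = x * y → s x = y * x → s x = p y → p x = s y → y = c x) ∧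
    (∀ x : S, x * c x * x = x) ∧
    (∀ x : S, c (c x) = x) ∧
    (∀ x y : S, c (x * y) = c (x * y) * x * c x) ∧
    (∀ x y : S, c (x * y) = c y * y * c (x * y)) ∧
    (∀ x y : S, c (x * y) * x = c (c x * x * y)) := by
  have pp : ∀ x, p x * p x = p x := fun x => by simpa only [h4] using h1 (p x)
  have ss : ∀ x, s x * s x = s x := fun x => by simpa only [h4'] using h1' (s x)
  have px : ∀ x, x * c x = p x := fun x => (hc x).1.symm
  have sx : ∀ x, c x * x = s x := fun x => (hc x).2.1.symm
  have pc : ∀ x, p (c x) = s x := fun x => (hc x).2.2.1.symm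
  have sc : ∀ x, s (c x) = p x := fun x => (hc x).2.2.2.symm
  have uniq : ∀ x y : S, p x = x * y → s x = y * x → s x = p y → p x = s y → y = c x := by
    intro x y _ e2 _ e4
    calc y = y * p x := by rw [e4, h1']
      _ = s x * c x := by rw [← px, ← mul_assoc, ← e2]
      _ = c x := by rw [← pc, h1]
  have p_mul_p : ∀ x y, p (x * y) * p x = p (x * y) := fun x y => by
    rw [h3, mul_assoc, pp]
  have p_p_mul : ∀ x y, p x * p (x * y) = p (x * y) := fun x y => by
    rw [h3, ← mul_assoc, ← mul_assoc, pp]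
  have s_s_mul : ∀ x y, s y * s (x * y) = s (x * y) := fun x y => by
    rw [h3', ← mul_assoc, ← mul_assoc, ss]
  have c_mul_p : ∀ x y, c (x * y) * p x = c (x * y) := fun x y => by
    calc c (x * y) * p x = c (x * y) * p (x * y) * p x := by rw [← sc (x * y), h1']
      _ = c (x * y) := by rw [mul_assoc, p_mul_p, ← sc (x * y), h1']
  have s_mul_c : ∀ x y, s y * c (x * y) = c (x * y) := fun x y => by
    calc s y * c (x * y) = s y * (s (x * y) * c (x * y)) := by rw [← pc (x * y), h1]
      _ = c (x * y) := by rw [← mul_assoc, s_s_mul, ← pc (x * y), h1]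
  have s_mul_pz : ∀ x y, s x * p (s x * y) = p (s x * y) := fun x y => by
    simpa only [h5'] using p_p_mul (s x) y
  refine ⟨uniq, fun x => by rw [px, h1], fun x => ?_, fun x y => ?_, fun x y => ?_,
    fun x y => ?_⟩
  · exact (uniq (c x) x (by rw [pc, sx]) (by rw [sc, px]) (sc x) (pc x)).symm
  · rw [mul_assoc, px, c_mul_p]
  · rw [sx, s_mul_c]
  · rw [sx]
    apply uniq
    · calc p (s x * y) = s x * p (s x * y) := (s_mul_pz x y).symm
        _ = c x * (p (x * y) * x) := by rw [h6', ← mul_assoc, sx]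
        _ = s x * y * (c (x * y) * x) := by
          rw [← px (x * y), ← sx x]; simp only [mul_assoc]
    · calc s (s x * y) = c (x * y) * (x * s x * y) := by rw [← h2', h1', sx]
        _ = c (x * y) * x * (s x * y) := by simp only [mul_assoc]
    · rw [← h2', h2 (c (x * y)) x, c_mul_p, pc]
    · rw [h2' (c (x * y)) x, sc, h6', h2' x, s_mul_pz, h5]
end

section
/- Let (S,·) be a semigroup with unary operations x ↦ x⁺ and x ↦ x* satisfying, for all x,y ∈ S, the axioms (i) x⁺x = x; (ii) (xy)⁺ = (xy⁺)⁺; (iv) (x⁺)⁺ = x⁺; (v) (x⁺)* = x⁺; (i)′ xx* = x; (ii)′ (xy)* = (x*y)*; (iv)′ (x*)* = x*; (v)′ (x*)⁺ = x*. Then S satisfies both (iii) (xy)⁺ = x⁺(xy)⁺x⁺ and (iii)′ (xy)* = y*(xy)*y* for all x,y ∈ S if and only if S satisfies both (x⁺y⁺)⁺ = x⁺(x⁺y⁺)⁺x⁺ and (x*y*)* = y*(x*y*)*y* for all x,y ∈ S. -/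
/-- In the DRC axioms, the axioms (iii) `(xy)⁺ = x⁺(xy)⁺x⁺` and (iii)′
`(xy)* = y*(xy)*y*` may be replaced by their specializations to projections:
`(x⁺y⁺)⁺ = x⁺(x⁺y⁺)⁺x⁺` and `(x*y*)* = y*(x*y*)*y*`. -/
theorem stmt_3 (S : Type*) [Semigroup S] (p s : S → S)
    (h1 : ∀ x : S, p x * x = x)
    (h2 : ∀ x y : S, p (x * y) = p (x * p y))
    (h4 : ∀ x : S, p (p x) = p x)
    (h5 : ∀ x : S, s (p x) = p x)
    (h1' : ∀ x : S, x * s x = x)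
    (h2' : ∀ x y : S, s (x * y) = s (s x * y))
    (h4' : ∀ x : S, s (s x) = s x)
    (h5' : ∀ x : S, p (s x) = s x) :
    ((∀ x y : S, p (x * y) = p x * p (x * y) * p x) ∧
     (∀ x y : S, s (x * y) = s y * s (x * y) * s y)) ↔
    ((∀ x y : S, p (p x * p y) = p x * p (p x * p y) * p x) ∧
     (∀ x y : S, s (s x * s y) = s y * s (s x * s y) * s y)) := by
  constructor
  · rintro ⟨hp, hs⟩
    refine ⟨fun x y => ?_, fun x y => ?_⟩
    · simpa only [h4] using hp (p x) (p y)
    · simpa only [h4'] using hs (s x) (s y)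
  · rintro ⟨hp, hs⟩
    refine ⟨fun x y => ?_, fun x y => ?_⟩
    · have h : p (p x * p (x * y)) = p (x * y) := by
        rw [← h2, ← mul_assoc, h1]
      simpa only [h] using hp x (x * y)
    · have h : s (s (x * y) * s y) = s (x * y) := by
        rw [← h2', mul_assoc, h1']
      simpa only [h] using hs (x * y) y
end

section
/- Let (S,·,⁺,*) be a DRC semigroup. Define binary operations on P(S) by e ×_S f = (ef)⁺ and e ⋆_S f = (ef)* for e,f ∈ P(S). Then (P(S), ×_S, ⋆_S) is a (two-sided) projection algebra. Moreover, if S is a DRC-restriction semigroup, then (P(S), ×_S, ⋆_S) is a strong projection algebra. -/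
/-- For a DRC semigroup `S`, the operations `e ×_S f = (ef)⁺` and
`e ⋆_S f = (ef)*` make the set of projections `P(S)` a two-sided projection
algebra; if moreover `S` is DRC-restriction, then this projection algebra is
strong. -/
theorem stmt_4 (S : Type*) [Semigroup S] (p s : S → S)
    (h1 : ∀ x : S, p x * x = x)
    (h2 : ∀ x y : S, p (x * y) = p (x * p y))
    (h3 : ∀ x y : S, p (x * y) = p x * p (x * y) * p x)
    (h4 : ∀ x : S, p (p x) = p x)
    (h5 : ∀ x : S, s (p x) = p x)
    (h1' : ∀ x : S, x * s x = x)
    (h2' : ∀ x y : S, s (x * y) = s (s x * y))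
    (h3' : ∀ x y : S, s (x * y) = s y * s (x * y) * s y)
    (h4' : ∀ x : S, s (s x) = s x)
    (h5' : ∀ x : S, p (s x) = s x) :
    (∀ e f g : S, e ∈ Set.range p → f ∈ Set.range p → g ∈ Set.range p →
      -- (L1)–(L4)
      (p (e * e) = e) ∧
      (p (p (e * f) * e) = p (e * f)) ∧
      (p (e * p (f * g)) = p (p (e * f) * p (f * g))) ∧
      (p (p (e * f) * g) = p (p (e * f) * p (e * g))) ∧
      -- (R1)–(R4)
      (s (e * e) = e) ∧
      (s (f * e) = s (e * s (f * e))) ∧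
      (s (s (g * f) * e) = s (s (g * f) * s (f * e))) ∧
      (s (g * s (f * e)) = s (s (g * e) * s (f * e))) ∧
      -- (P3)
      (s (s (e * p (f * g)) * g) = s (s (e * f) * g)) ∧
      (p (g * p (s (g * f) * e)) = p (g * p (f * e))) ∧
      -- (P4)
      (s (p (e * f) * e) = p (e * f)) ∧
      (p (f * s (e * f)) = s (e * f))) ∧
    (((∀ x y : S, x * s (y * x) = s (y * p x) * x) ∧
      (∀ x y : S, p (x * y) * x = x * p (s x * y))) →
      ∀ e f g : S, e ∈ Set.range p → f ∈ Set.range p → g ∈ Set.range p →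
        -- (SP1)
        (p (e * s (p (p (e * f) * g) * f)) = p (p (e * f) * g)) ∧
        -- (SP2)
        (s (p (f * s (g * s (f * e))) * e) = s (g * s (f * e)))) := by
  have pp : ∀ x, p x * p x = p x := fun x => by simpa only [h4] using h1 (p x)
  have p_left : ∀ x y, p x * p (x * y) = p (x * y) := fun x y => by
    rw [h3 x y, ← mul_assoc, ← mul_assoc, pp]
  have p_right : ∀ x y, p (x * y) * p x = p (x * y) := fun x y => by
    rw [h3 x y, mul_assoc _ (p x), pp]
  have ss : ∀ x, s x * s x = s x := fun x => by simpa only [h4'] using h1' (s x)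
  have s_left : ∀ x y, s y * s (x * y) = s (x * y) := fun x y => by
    rw [h3' x y, ← mul_assoc, ← mul_assoc, ss]
  have s_right : ∀ x y, s (x * y) * s y = s (x * y) := fun x y => by
    rw [h3' x y, mul_assoc _ (s y), ss]
  have proj : ∀ e ∈ Set.range p, p e = e ∧ s e = e ∧ e * e = e := by
    rintro _ ⟨x, rfl⟩
    exact ⟨h4 x, h5 x, pp x⟩
  have p_mul_left : ∀ e ∈ Set.range p, ∀ x, e * p (e * x) = p (e * x) := fun e he x => by
    simpa only [(proj e he).1] using p_left e x
  have p_mul_right : ∀ e ∈ Set.range p, ∀ x, p (e * x) * e = p (e * x) := fun e he x => by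
    simpa only [(proj e he).1] using p_right e x
  have s_mul_left : ∀ e ∈ Set.range p, ∀ x, e * s (x * e) = s (x * e) := fun e he x => by
    simpa only [(proj e he).2.1] using s_left x e
  have s_mul_right : ∀ e ∈ Set.range p, ∀ x, s (x * e) * e = s (x * e) := fun e he x => by
    simpa only [(proj e he).2.1] using s_right x e
  have p_mul : ∀ e ∈ Set.range p, ∀ x, p (e * x) * x = e * x := fun e he x => by
    rw [← p_mul_right e he x, mul_assoc, h1]
  have mul_s : ∀ e ∈ Set.range p, ∀ x, x * s (x * e) = x * e := fun e he x => by
    rw [← s_mul_left e he x, ← mul_assoc, h1']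
  refine ⟨fun e f g he hf hg => ⟨?_, ?_, ?_, ?_, ?_, ?_, ?_, ?_, ?_, ?_, ?_, ?_⟩,
    fun ⟨ample, ample'⟩ e f g he hf hg => ⟨?_, ?_⟩⟩
  · rw [(proj e he).2.2, (proj e he).1]
  · rw [p_mul_right e he, h4]
  · rw [← p_mul_left f hf g, ← mul_assoc, ← mul_assoc, p_mul e he]
  · rw [← h2, ← mul_assoc, p_mul_right e he]
  · rw [(proj e he).2.2, (proj e he).2.1]
  · rw [s_mul_left e he, h4']
  · rw [← s_mul_right f hf g, mul_assoc _ f, mul_assoc _ f, mul_s e he]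
  · rw [← h2', mul_assoc, s_mul_left e he]
  · rw [← h2', mul_assoc, p_mul f hf, ← mul_assoc, h2']
  · rw [← h2, ← mul_assoc, mul_s f hf, mul_assoc, h2]
  · rw [p_mul_right e he, h5]
  · rw [s_mul_left f hf, h5']
  · set v := p (p (e * f) * g)
    have hvu : v * p (e * f) = v := p_mul_right _ ⟨_, rfl⟩ g
    have hve : v * e = v := by rw [← hvu, mul_assoc, p_mul_right e he]
    have key : e * s (v * f) = v * f := by
      have h := ample (e * f) v
      rwa [hvu, (proj v ⟨_, rfl⟩).2.1, ← mul_assoc v, hve, mul_assoc e,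
        s_mul_left f hf] at h
    rw [key]
    conv_lhs => rw [← hve, mul_assoc, h2, hvu]
    exact h4 _
  · set w := s (g * s (f * e))
    have huw : s (f * e) * w = w := by simpa only [h4'] using s_left g (s (f * e))
    have hew : e * w = w := by rw [← huw, ← mul_assoc, s_mul_left e he]
    have key : p (f * w) * e = f * w := by
      have h := ample' (f * e) w
      rwa [huw, h5', mul_assoc f e w, hew, ← mul_assoc, p_mul_right f hf] at h
    rw [key]
    conv_lhs => rw [← hew, ← mul_assoc, h2', huw]
    exact h4' _
end

section
/- Let (S,·,⁺,*) be a DRC semigroup. Then the relations ≤ʳ and ≤ˡ are partial orders on S, and for all e,f ∈ P(S) the following are equivalent: e ≤ʳ f; fef = e; e ≤ˡ f; e = (fe)⁺ (i.e. e ≤ f in the natural partial order of the projection algebra (P(S), ×_S, ⋆_S) where e ×_S f = (ef)⁺). -/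
theorem mul_eq_left_of_conj_eq {S : Type*} [Semigroup S] {e f : S} (hf : f * f = f)
    (h : f * e * f = e) : f * e = e := by
  conv_lhs => rw [← h]
  rw [← mul_assoc, ← mul_assoc, hf, h]

theorem mul_eq_right_of_conj_eq {S : Type*} [Semigroup S] {e f : S} (hf : f * f = f)
    (h : f * e * f = e) : e * f = e := by
  conv_lhs => rw [← h]
  rw [mul_assoc, hf, h]

theorem conj_eq_trans {S : Type*} [Semigroup S] {e f g : S} (hf : f * f = f) (hg : g * g = g)
    (hef : f * e * f = e) (hfg : g * f * g = f) : g * e * g = e := by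
  have hge : g * e = e := by
    rw [← mul_eq_left_of_conj_eq hf hef, ← mul_assoc, mul_eq_left_of_conj_eq hg hfg]
  have heg : e * g = e := by
    rw [← mul_eq_right_of_conj_eq hf hef, mul_assoc, mul_eq_right_of_conj_eq hg hfg]
  rw [hge, heg]

theorem conj_eq_antisymm {S : Type*} [Semigroup S] {e f : S} (he : e * e = e) (hf : f * f = f)
    (hef : f * e * f = e) (hfe : e * f * e = f) : e = f := by
  rw [← mul_eq_right_of_conj_eq hf hef, mul_eq_left_of_conj_eq he hfe]


/-- In a DRC semigroup, `≤ʳ` and `≤ˡ` are partial orders on `S`, and for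
projections `e, f ∈ P(S)` the conditions `e ≤ʳ f`, `fef = e`, `e ≤ˡ f` and
`e = (fe)⁺` are all equivalent. -/
theorem stmt_5 (S : Type*) [Semigroup S] (p s : S → S)
    (h1 : ∀ x : S, p x * x = x)
    (h2 : ∀ x y : S, p (x * y) = p (x * p y))
    (h3 : ∀ x y : S, p (x * y) = p x * p (x * y) * p x)
    (h4 : ∀ x : S, p (p x) = p x)
    (h5 : ∀ x : S, s (p x) = p x)
    (h1' : ∀ x : S, x * s x = x)
    (h2' : ∀ x y : S, s (x * y) = s (s x * y))
    (h3' : ∀ x y : S, s (x * y) = s y * s (x * y) * s y)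
    (h4' : ∀ x : S, s (s x) = s x)
    (h5' : ∀ x : S, p (s x) = s x)
    (leR leL : S → S → Prop)
    (hleR : ∀ a b : S, leR a b ↔ (a = p a * b ∧ p b * p a * p b = p a))
    (hleL : ∀ a b : S, leL a b ↔ (a = b * s a ∧ s b * s a * s b = s a)) :
    -- ≤ʳ is a partial order
    ((∀ a : S, leR a a) ∧ (∀ a b : S, leR a b → leR b a → a = b) ∧
     (∀ a b c : S, leR a b → leR b c → leR a c)) ∧
    -- ≤ˡ is a partial order
    ((∀ a : S, leL a a) ∧ (∀ a b : S, leL a b → leL b a → a = b) ∧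
     (∀ a b c : S, leL a b → leL b c → leL a c)) ∧
    -- on projections all four conditions coincide
    (∀ e f : S, e ∈ Set.range p → f ∈ Set.range p →
      (leR e f ↔ f * e * f = e) ∧
      (f * e * f = e ↔ leL e f) ∧
      (leL e f ↔ e = p (f * e))) := by
  have hp : ∀ x, p x * p x = p x := fun x => by simpa only [h4] using h1 (p x)
  have hs : ∀ x, s x * s x = s x := fun x => by simpa only [h4'] using h1' (s x)
  refine ⟨⟨fun a => ?_, fun a b hab hba => ?_, fun a b c hab hbc => ?_⟩,
    ⟨fun a => ?_, fun a b hab hba => ?_, fun a b c hab hbc => ?_⟩, ?_⟩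
  · rw [hleR, h1, hp, hp]
    exact ⟨rfl, rfl⟩
  · rw [hleR] at hab hba
    rw [hab.1, conj_eq_antisymm (hp a) (hp b) hab.2 hba.2, h1]
  · rw [hleR] at *
    refine ⟨?_, conj_eq_trans (hp b) (hp c) hab.2 hbc.2⟩
    calc a = p a * (p b * c) := by rw [← hbc.1, ← hab.1]
      _ = p a * c := by rw [← mul_assoc, mul_eq_right_of_conj_eq (hp b) hab.2]
  · rw [hleL, h1', hs, hs]
    exact ⟨rfl, rfl⟩
  · rw [hleL] at hab hba
    rw [hab.1, conj_eq_antisymm (hs a) (hs b) hab.2 hba.2, h1']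
  · rw [hleL] at *
    refine ⟨?_, conj_eq_trans (hs b) (hs c) hab.2 hbc.2⟩
    calc a = c * s b * s a := by rw [← hbc.1, ← hab.1]
      _ = c * s a := by rw [mul_assoc, mul_eq_left_of_conj_eq (hs b) hab.2]
  · rintro _ _ ⟨x, rfl⟩ ⟨y, rfl⟩
    have hL : leL (p x) (p y) ↔ p y * p x * p y = p x := by
      rw [hleL, h5, h5]
      exact ⟨And.right, fun h => ⟨(mul_eq_left_of_conj_eq (hp y) h).symm, h⟩⟩
    refine ⟨?_, hL.symm, hL.trans ⟨fun h => ?_, fun h => ?_⟩⟩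
    · rw [hleR, h4, h4]
      exact ⟨And.right, fun h => ⟨(mul_eq_right_of_conj_eq (hp y) h).symm, h⟩⟩
    · rw [mul_eq_left_of_conj_eq (hp y) h, h4]
    · have h' := h3 (p y) (p x)
      rw [← h, h4] at h'
      exact h'.symm
end

section
/- Let (S,·,⁺,*) be a DRC semigroup. Then the relations ≤ʳ and ≤ˡ coincide (a ≤ʳ b if and only if a ≤ˡ b, for all a,b ∈ S) if and only if S satisfies the DRC-ample conditions x(yx)* = (yx⁺)*x and (xy)⁺x = x(x*y)⁺ for all x,y ∈ S (i.e. S is DRC-restriction). -/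
/-- In a DRC semigroup, the relations `≤ʳ` and `≤ˡ` coincide if and only if the
DRC-ample conditions hold (i.e. `S` is DRC-restriction). -/
theorem stmt_6 (S : Type*) [Semigroup S] (p s : S → S)
    (h1 : ∀ x : S, p x * x = x)
    (h2 : ∀ x y : S, p (x * y) = p (x * p y))
    (h3 : ∀ x y : S, p (x * y) = p x * p (x * y) * p x)
    (h4 : ∀ x : S, p (p x) = p x)
    (h5 : ∀ x : S, s (p x) = p x)
    (h1' : ∀ x : S, x * s x = x)
    (h2' : ∀ x y : S, s (x * y) = s (s x * y))
    (h3' : ∀ x y : S, s (x * y) = s y * s (x * y) * s y)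
    (h4' : ∀ x : S, s (s x) = s x)
    (h5' : ∀ x : S, p (s x) = s x) :
    (∀ a b : S, (a = p a * b ∧ p b * p a * p b = p a) ↔
                (a = b * s a ∧ s b * s a * s b = s a)) ↔
    ((∀ x y : S, x * s (y * x) = s (y * p x) * x) ∧
     (∀ x y : S, p (x * y) * x = x * p (s x * y))) := by
  have hpp (x : S) : p x * p x = p x := by simpa only [h4] using h1 (p x)
  have hss (x : S) : s x * s x = s x := by simpa only [h4'] using h1' (s x)
  have left_absorb {e f : S} (hf : f * f = f) (h : f * e * f = e) : f * e = e := by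
    rw [← h, mul_assoc f e f, ← mul_assoc f f, hf]
  have right_absorb {e f : S} (hf : f * f = f) (h : f * e * f = e) : e * f = e := by
    rw [← h, mul_assoc (f * e) f f, hf]
  constructor
  · intro h
    constructor
    · intro x y
      have hle : p x * s (y * p x) * p x = s (y * p x) := by
        simpa only [h5] using (h3' y (p x)).symm
      have hp : p (s (y * p x) * x) = s (y * p x) := by
        rw [h2, right_absorb (hpp x) hle, h5']
      have hs : s (s (y * p x) * x) = s (y * x) := by
        rw [← h2', mul_assoc, h1]
      have key := ((h (s (y * p x) * x) x).mp ⟨by rw [hp], by rw [hp, hle]⟩).1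
      rw [hs] at key
      exact key.symm
    · intro x y
      have hle : s x * p (s x * y) * s x = p (s x * y) := by
        simpa only [h5'] using (h3 (s x) y).symm
      have hs : s (x * p (s x * y)) = p (s x * y) := by
        rw [h2', left_absorb (hss x) hle, h5]
      have hp : p (x * p (s x * y)) = p (x * y) := by
        rw [← h2, ← mul_assoc, h1']
      have key := ((h (x * p (s x * y)) x).mpr ⟨by rw [hs], by rw [hs, hle]⟩).1
      rw [hp] at key
      exact key.symm
  · rintro ⟨ample_right, ample_left⟩ a b
    constructor
    · rintro ⟨hab, hle⟩
      have key := ample_right b (p a)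
      have hs := h3' (p a) b
      rw [right_absorb (hpp b) hle, h5, ← hab] at key
      rw [← hab] at hs
      exact ⟨key.symm, hs.symm⟩
    · rintro ⟨hab, hle⟩
      have key := ample_left b (s a)
      have hp := h3 b (s a)
      rw [left_absorb (hss b) hle, h5', ← hab] at key
      rw [← hab] at hp
      exact ⟨key.symm, hp.symm⟩
end

section
/- Let (S,·,⁺,*) be a DRC-restriction semigroup with natural partial order ≤ (which is ≤ʳ = ≤ˡ). Then: (1) for a,b ∈ S, a ≤ b if and only if a = a⁺b = ba*; (2) if a ≤ b, c ≤ d, a* = c⁺ and b* = d⁺, then ac ≤ bd. -/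
/-- In a DRC-restriction semigroup with natural partial order `≤` (which equals
`≤ʳ = ≤ˡ`): (1) `a ≤ b` iff `a = a⁺b = ba*`; (2) if `a ≤ b`, `c ≤ d`,
`a* = c⁺` and `b* = d⁺`, then `ac ≤ bd`. -/
theorem stmt_8 (S : Type*) [Semigroup S] (p s : S → S)
    (h1 : ∀ x : S, p x * x = x)
    (h2 : ∀ x y : S, p (x * y) = p (x * p y))
    (h3 : ∀ x y : S, p (x * y) = p x * p (x * y) * p x)
    (h4 : ∀ x : S, p (p x) = p x)
    (h5 : ∀ x : S, s (p x) = p x)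
    (h1' : ∀ x : S, x * s x = x)
    (h2' : ∀ x y : S, s (x * y) = s (s x * y))
    (h3' : ∀ x y : S, s (x * y) = s y * s (x * y) * s y)
    (h4' : ∀ x : S, s (s x) = s x)
    (h5' : ∀ x : S, p (s x) = s x)
    (h6 : ∀ x y : S, x * s (y * x) = s (y * p x) * x)
    (h6' : ∀ x y : S, p (x * y) * x = x * p (s x * y))
    (le : S → S → Prop)
    (hle : ∀ a b : S, le a b ↔ (a = p a * b ∧ p b * p a * p b = p a)) :
    (∀ a b : S, le a b ↔ (a = p a * b ∧ a = b * s a)) ∧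
    (∀ a b c d : S, le a b → le c d → s a = p c → s b = p d → le (a * c) (b * d)) := by
  have key : ∀ a b : S, le a b ↔ (a = p a * b ∧ a = b * s a) := by
    intro a b
    rw [hle]
    refine ⟨fun ⟨hab, hp⟩ => ⟨hab, ?_⟩, fun ⟨hab, hba⟩ => ⟨hab, ?_⟩⟩
    · have idem : p b * p b = p b := by simpa only [h4] using h1 (p b)
      have absorb : p a * p b = p a := by
        rw [← hp, mul_assoc, idem]
      have h := h6 b (p a)
      rw [← hab, absorb, h5, ← hab] at h
      exact h.symm
    · have h := h3 b (s a)
      rw [← hba] at h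
      exact h.symm
  refine ⟨key, fun a b c d hab hcd hac _ => ?_⟩
  obtain ⟨hab, hba⟩ := (key a b).1 hab
  obtain ⟨hcd, hdc⟩ := (key c d).1 hcd
  have left_eq : a * c = a * d := by
    conv_lhs => rw [hcd, ← hac, ← mul_assoc, h1']
  have right_eq : a * c = b * c := by
    conv_lhs => rw [hba, hac, mul_assoc, h1]
  have hp : p (a * c) = p a := by rw [h2, ← hac, h1']
  have hs : s (a * c) = s c := by rw [h2', hac, h1]
  rw [key, hp, hs]
  constructor
  · rw [← mul_assoc, ← hab, left_eq]
  · rw [mul_assoc, ← hdc, right_eq]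
end

section
/- Let (S,·,⁺,*) be a DRC semigroup. Then S satisfies the DRC-ample conditions (i.e. S is DRC-restriction) if and only if the maps ρ_a : {x ∈ P(S) : a⁺xa⁺ = x} → {y ∈ P(S) : a*ya* = y}, x ↦ (xa)*, and σ_a : {y ∈ P(S) : a*ya* = y} → {x ∈ P(S) : a⁺xa⁺ = x}, y ↦ (ay)⁺, are mutually inverse bijections for every a ∈ S; equivalently, if and only if for all a ∈ S: (a·(ea)*)⁺ = e for every e ∈ P(S) with a⁺ea⁺ = e, and ((af)⁺·a)* = f for every f ∈ P(S) with a*fa* = f. -/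
/-- A DRC semigroup is DRC-restriction (satisfies the DRC-ample conditions) if
and only if for every `a ∈ S` the maps `ρ_a : x ↦ (xa)*` and `σ_a : y ↦ (ay)⁺`
are mutually inverse bijections between `{x ∈ P(S) : a⁺xa⁺ = x}` and
`{y ∈ P(S) : a*ya* = y}`; equivalently, iff for all `a`:
`(a·(ea)*)⁺ = e` whenever `e ∈ P(S)` with `a⁺ea⁺ = e`, and
`((af)⁺·a)* = f` whenever `f ∈ P(S)` with `a*fa* = f`. -/
theorem stmt_9 (S : Type*) [Semigroup S] (p s : S → S)
    (h1 : ∀ x : S, p x * x = x)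
    (h2 : ∀ x y : S, p (x * y) = p (x * p y))
    (h3 : ∀ x y : S, p (x * y) = p x * p (x * y) * p x)
    (h4 : ∀ x : S, p (p x) = p x)
    (h5 : ∀ x : S, s (p x) = p x)
    (h1' : ∀ x : S, x * s x = x)
    (h2' : ∀ x y : S, s (x * y) = s (s x * y))
    (h3' : ∀ x y : S, s (x * y) = s y * s (x * y) * s y)
    (h4' : ∀ x : S, s (s x) = s x)
    (h5' : ∀ x : S, p (s x) = s x) :
    ((∀ x y : S, x * s (y * x) = s (y * p x) * x) ∧
     (∀ x y : S, p (x * y) * x = x * p (s x * y))) ↔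
    (∀ a : S,
      (∀ e : S, e ∈ Set.range p → p a * e * p a = e → p (a * s (e * a)) = e) ∧
      (∀ f : S, f ∈ Set.range p → s a * f * s a = f → s (p (a * f) * a) = f)) := by
  have hpp (x : S) : p x * p x = p x := by simpa only [h4] using h1 (p x)
  have hss (x : S) : s x * s x = s x := by simpa only [h4'] using h1' (s x)
  constructor
  · rintro ⟨hl, hr⟩ a
    constructor
    · rintro _ ⟨z, rfl⟩ he
      have hright : p z * p a = p z := by
        rw [← he, mul_assoc, hpp]
      rw [hl, hright, h5, h2, hright, h4]
    · rintro _ ⟨z, rfl⟩ hf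
      have hleft : s a * p z = p z := by
        rw [← hf, ← mul_assoc, ← mul_assoc, hss]
      rw [hr, hleft, h4, h2', hleft, h5]
  · intro h
    constructor
    · intro x y
      have he := (h x).1 (s (y * p x)) ⟨_, h5' _⟩
        (by simpa only [h5] using (h3' y (p x)).symm)
      have hs : s (s (y * p x) * x) = s (y * x) := by
        rw [← h2', mul_assoc, h1]
      have hx := h1 (x * s (s (y * p x) * x))
      rw [he, ← mul_assoc, h1', hs] at hx
      exact hx.symm
    · intro x y
      have hf := (h x).2 (p (s x * y)) ⟨_, rfl⟩
        (by simpa only [h5'] using (h3 (s x) y).symm)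
      have hp : p (x * p (s x * y)) = p (x * y) := by
        rw [← h2, ← mul_assoc, h1']
      have hx := h1' (p (x * p (s x * y)) * x)
      rw [hf, mul_assoc, h1, hp] at hx
      exact hx.symm
end

section
/- Let (S,·,⁺,*) be a DRC-restriction semigroup. Then the relation μ_S = {(a,b) ∈ S×S : a⁺ = b⁺, a* = b*, and (ap)⁺ = (bp)⁺ and (pa)* = (pb)* for all p ∈ P(S)} is the maximum projection-separating (2,1,1)-congruence on S; that is, μ_S is an equivalence relation compatible with multiplication and with both unary operations ⁺ and *, it separates projections, and every projection-separating (2,1,1)-congruence on S is contained in μ_S. -/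
/-- In a DRC-restriction semigroup, the relation `μ_S` (elements with the same
`⁺`, the same `*`, and the same action on projections on both sides) is the
maximum projection-separating (2,1,1)-congruence. -/
theorem stmt_10 (S : Type*) [Semigroup S] (p s : S → S)
    (h1 : ∀ x : S, p x * x = x)
    (h2 : ∀ x y : S, p (x * y) = p (x * p y))
    (h3 : ∀ x y : S, p (x * y) = p x * p (x * y) * p x)
    (h4 : ∀ x : S, p (p x) = p x)
    (h5 : ∀ x : S, s (p x) = p x)
    (h1' : ∀ x : S, x * s x = x)
    (h2' : ∀ x y : S, s (x * y) = s (s x * y))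
    (h3' : ∀ x y : S, s (x * y) = s y * s (x * y) * s y)
    (h4' : ∀ x : S, s (s x) = s x)
    (h5' : ∀ x : S, p (s x) = s x)
    (h6 : ∀ x y : S, x * s (y * x) = s (y * p x) * x)
    (h6' : ∀ x y : S, p (x * y) * x = x * p (s x * y))
    (mu : S → S → Prop)
    (hmu : ∀ a b : S, mu a b ↔
      (p a = p b ∧ s a = s b ∧
       ∀ q ∈ Set.range p, p (a * q) = p (b * q) ∧ s (q * a) = s (q * b))) :
    -- μ is an equivalence relation
    Equivalence mu ∧
    -- μ is a (2,1,1)-congruence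
    (∀ a b c : S, mu a b → mu (a * c) (b * c)) ∧
    (∀ a b c : S, mu a b → mu (c * a) (c * b)) ∧
    (∀ a b : S, mu a b → mu (p a) (p b)) ∧
    (∀ a b : S, mu a b → mu (s a) (s b)) ∧
    -- μ separates projections
    (∀ e f : S, e ∈ Set.range p → f ∈ Set.range p → mu e f → e = f) ∧
    -- μ is the maximum such congruence
    (∀ sigma : S → S → Prop, Equivalence sigma →
      (∀ a b c : S, sigma a b → sigma (a * c) (b * c)) →
      (∀ a b c : S, sigma a b → sigma (c * a) (c * b)) →
      (∀ a b : S, sigma a b → sigma (p a) (p b)) →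
      (∀ a b : S, sigma a b → sigma (s a) (s b)) →
      (∀ e f : S, e ∈ Set.range p → f ∈ Set.range p → sigma e f → e = f) →
      ∀ a b : S, sigma a b → mu a b) := by
  have refl_mu : ∀ a, mu a a := fun a => (hmu a a).2 ⟨rfl, rfl, fun _ _ => ⟨rfl, rfl⟩⟩
  have s_mem : ∀ x, s x ∈ Set.range p := fun x => ⟨s x, h5' x⟩
  refine ⟨⟨refl_mu, ?_, ?_⟩, ?_, ?_, ?_, ?_, ?_, ?_⟩
  · intro a b h
    obtain ⟨hp, hs, hq⟩ := (hmu a b).1 h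
    exact (hmu b a).2 ⟨hp.symm, hs.symm, fun q m => ⟨(hq q m).1.symm, (hq q m).2.symm⟩⟩
  · intro a b c h h'
    obtain ⟨hp, hs, hq⟩ := (hmu a b).1 h
    obtain ⟨hp', hs', hq'⟩ := (hmu b c).1 h'
    exact (hmu a c).2 ⟨hp.trans hp', hs.trans hs',
      fun q m => ⟨(hq q m).1.trans (hq' q m).1, (hq q m).2.trans (hq' q m).2⟩⟩
  · intro a b c h
    obtain ⟨hp, hs, hq⟩ := (hmu a b).1 h
    refine (hmu _ _).2 ⟨?_, ?_, fun q m => ⟨?_, ?_⟩⟩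
    · rw [h2 a c, h2 b c, (hq _ ⟨c, rfl⟩).1]
    · rw [h2' a c, h2' b c, hs]
    · rw [mul_assoc, mul_assoc, h2 a, h2 b, (hq _ ⟨c * q, rfl⟩).1]
    · rw [← mul_assoc, ← mul_assoc, h2' (q * a), h2' (q * b), (hq q m).2]
  · intro a b c h
    obtain ⟨hp, hs, hq⟩ := (hmu a b).1 h
    refine (hmu _ _).2 ⟨?_, ?_, fun q m => ⟨?_, ?_⟩⟩
    · rw [h2 c a, h2 c b, hp]
    · rw [h2' c a, h2' c b, (hq _ (s_mem c)).2]
    · rw [mul_assoc, mul_assoc, h2 c (a * q), h2 c (b * q), (hq q m).1]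
    · rw [← mul_assoc, ← mul_assoc, h2' (q * c) a, h2' (q * c) b, (hq _ (s_mem (q * c))).2]
  · intro a b h
    rw [((hmu a b).1 h).1]
    exact refl_mu _
  · intro a b h
    rw [((hmu a b).1 h).2.1]
    exact refl_mu _
  · rintro _ _ ⟨x, rfl⟩ ⟨y, rfl⟩ h
    simpa only [h4] using ((hmu _ _).1 h).1
  · intro sigma _ hr hl hp hs hsep a b h
    have p_eq : ∀ x y, sigma x y → p x = p y :=
      fun x y hxy => hsep _ _ ⟨x, rfl⟩ ⟨y, rfl⟩ (hp x y hxy)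
    have s_eq : ∀ x y, sigma x y → s x = s y :=
      fun x y hxy => hsep _ _ (s_mem x) (s_mem y) (hs x y hxy)
    exact (hmu a b).2 ⟨p_eq a b h, s_eq a b h,
      fun q _ => ⟨p_eq _ _ (hr a b q h), s_eq _ _ (hl a b q h)⟩⟩
end

section
/- Let (S,·,⁺,*) be a DRC-restriction semigroup and a,b ∈ S. Then the following are equivalent: (1) (a,b) ∈ μ_S; (2) (pa)* = (pb)* and (ap)⁺ = (bp)⁺ for all p ∈ P(S); (3) a⁺ = b⁺ and (pa)* = (pb)* for all p ∈ P(S) with a⁺pa⁺ = p; (4) a* = b* and (ap)⁺ = (bp)⁺ for all p ∈ P(S) with a*pa* = p. -/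
/-- Two idempotents, each lying below the other, coincide. -/
theorem eq_of_sandwich {S : Type*} [Semigroup S] {e f : S} (he : e * e = e) (hf : f * f = f)
    (hef : e = f * e * f) (hfe : f = e * f * e) : e = f := by
  have h : f * e = e := by
    conv_lhs => rw [hef]
    rw [← mul_assoc, ← mul_assoc, hf, ← hef]
  have h' : f * e = f := by
    conv_lhs => rw [hfe]
    rw [mul_assoc, he, ← hfe]
  exact h.symm.trans h'

/-- In a DRC-restriction semigroup, if `a⁺ = b⁺` and `(qa)* = (qb)*` for all projections `q` below
`a⁺`, then the same holds for all projections, and moreover `a* = b*` and `(aq)⁺ = (bq)⁺`. -/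
theorem forall_projection_eq_of_le {S : Type*} [Semigroup S] (p s : S → S)
    (h1 : ∀ x : S, p x * x = x)
    (h2 : ∀ x y : S, p (x * y) = p (x * p y))
    (h3 : ∀ x y : S, p (x * y) = p x * p (x * y) * p x)
    (h4 : ∀ x : S, p (p x) = p x)
    (h5 : ∀ x : S, s (p x) = p x)
    (h1' : ∀ x : S, x * s x = x)
    (h2' : ∀ x y : S, s (x * y) = s (s x * y))
    (h3' : ∀ x y : S, s (x * y) = s y * s (x * y) * s y)
    (h5' : ∀ x : S, p (s x) = s x)
    (h6 : ∀ x y : S, x * s (y * x) = s (y * p x) * x)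
    (h6' : ∀ x y : S, p (x * y) * x = x * p (s x * y))
    (a b : S) (hp : p a = p b)
    (hq : ∀ q ∈ Set.range p, p a * q * p a = q → s (q * a) = s (q * b)) :
    s a = s b ∧ ∀ q ∈ Set.range p, p (a * q) = p (b * q) ∧ s (q * a) = s (q * b) := by
  have idem (x : S) : p x * p x = p x := by simpa only [h4] using h1 (p x)
  have below (x y : S) : p x * p (x * y) = p (x * y) ∧ p (x * y) * p x = p (x * y) := by
    constructor
    · rw [h3, ← mul_assoc, ← mul_assoc, idem]
    · rw [h3, mul_assoc, idem]
  have hs : s a = s b := by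
    have h := hq (p a) ⟨a, rfl⟩ (by rw [idem, idem])
    rwa [h1, hp, h1] at h
  refine ⟨hs, fun q _ => ⟨?_, ?_⟩⟩
  · have reduce (x : S) : p (x * q) = p (x * p (s x * q)) := by
      rw [← h2, ← mul_assoc, h1']
    have hsu : s a * p (s a * q) = p (s a * q) := by
      simpa only [h5'] using (below (s a) q).1
    have hs_ra : s (p (a * q) * a) = p (s a * q) := by
      rw [h6', h2', hsu, h5]
    have hs_rb : s (p (a * q) * b) = p (s a * q) := by
      rw [← hs_ra]
      exact (hq _ ⟨_, rfl⟩ (h3 a q).symm).symm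
    have hr : p (a * q) * p b = p (a * q) := by rw [← hp, (below a q).2]
    have hb : b * p (s a * q) = p (a * q) * b := by
      rw [← hs_rb, h6, hr, h5]
    rw [reduce b, ← hs, hb, h2 _ b, hr, h4]
  · have reduce (x : S) : s (q * x) = s (s (q * p x) * x) := by
      rw [← h2', mul_assoc, h1]
    rw [reduce a, reduce b, ← hp]
    refine hq _ ⟨s (q * p a), h5' _⟩ ?_
    simpa only [h5] using (h3' q (p a)).symm


/-- In a DRC-restriction semigroup, for `a, b ∈ S` the following are
equivalent: (1) `(a,b) ∈ μ_S`; (2) `(pa)* = (pb)*` and `(ap)⁺ = (bp)⁺` for all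
`p ∈ P(S)`; (3) `a⁺ = b⁺` and `(pa)* = (pb)*` for all `p ∈ P(S)` with
`a⁺pa⁺ = p`; (4) `a* = b*` and `(ap)⁺ = (bp)⁺` for all `p ∈ P(S)` with
`a*pa* = p`. -/
theorem stmt_11 (S : Type*) [Semigroup S] (p s : S → S)
    (h1 : ∀ x : S, p x * x = x)
    (h2 : ∀ x y : S, p (x * y) = p (x * p y))
    (h3 : ∀ x y : S, p (x * y) = p x * p (x * y) * p x)
    (h4 : ∀ x : S, p (p x) = p x)
    (h5 : ∀ x : S, s (p x) = p x)
    (h1' : ∀ x : S, x * s x = x)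
    (h2' : ∀ x y : S, s (x * y) = s (s x * y))
    (h3' : ∀ x y : S, s (x * y) = s y * s (x * y) * s y)
    (h4' : ∀ x : S, s (s x) = s x)
    (h5' : ∀ x : S, p (s x) = s x)
    (h6 : ∀ x y : S, x * s (y * x) = s (y * p x) * x)
    (h6' : ∀ x y : S, p (x * y) * x = x * p (s x * y))
    (mu : S → S → Prop)
    (hmu : ∀ a b : S, mu a b ↔
      (p a = p b ∧ s a = s b ∧
       ∀ q ∈ Set.range p, p (a * q) = p (b * q) ∧ s (q * a) = s (q * b)))
    (a b : S) :
    (mu a b ↔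
      (∀ q ∈ Set.range p, s (q * a) = s (q * b) ∧ p (a * q) = p (b * q))) ∧
    (mu a b ↔
      (p a = p b ∧
       ∀ q ∈ Set.range p, p a * q * p a = q → s (q * a) = s (q * b))) ∧
    (mu a b ↔
      (s a = s b ∧
       ∀ q ∈ Set.range p, s a * q * s a = q → p (a * q) = p (b * q))) := by
  have left := forall_projection_eq_of_le p s h1 h2 h3 h4 h5 h1' h2' h3' h5' h6 h6' a b
  have hrange : Set.range s = Set.range p :=
    Set.Subset.antisymm (Set.range_subset_iff.2 fun x => ⟨s x, h5' x⟩)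
      (Set.range_subset_iff.2 fun x => ⟨p x, h5 x⟩)
  have right (hs : s a = s b)
      (hq : ∀ q ∈ Set.range p, s a * q * s a = q → p (a * q) = p (b * q)) :
      p a = p b ∧ ∀ q ∈ Set.range p, s (q * a) = s (q * b) ∧ p (a * q) = p (b * q) := by
    have h := forall_projection_eq_of_le (S := Sᵐᵒᵖ)
      (fun x => .op (s x.unop)) (fun x => .op (p x.unop))
      (fun x => congrArg MulOpposite.op (h1' x.unop))
      (fun x y => congrArg MulOpposite.op (h2' y.unop x.unop))
      (fun x y => congrArg MulOpposite.op ((h3' y.unop x.unop).trans (mul_assoc _ _ _)))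
      (fun x => congrArg MulOpposite.op (h4' x.unop))
      (fun x => congrArg MulOpposite.op (h5' x.unop))
      (fun x => congrArg MulOpposite.op (h1 x.unop))
      (fun x y => congrArg MulOpposite.op (h2 y.unop x.unop))
      (fun x y => congrArg MulOpposite.op ((h3 y.unop x.unop).trans (mul_assoc _ _ _)))
      (fun x => congrArg MulOpposite.op (h5 x.unop))
      (fun x y => congrArg MulOpposite.op (h6' x.unop y.unop))
      (fun x y => congrArg MulOpposite.op (h6 x.unop y.unop))
      (.op a) (.op b) (congrArg MulOpposite.op hs) (by
        rintro _ ⟨x, rfl⟩ hx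
        refine congrArg MulOpposite.op (hq (s x.unop) (hrange ▸ ⟨_, rfl⟩) ?_)
        exact (mul_assoc _ _ _).trans (congrArg MulOpposite.unop hx))
    refine ⟨congrArg MulOpposite.unop h.1, ?_⟩
    rw [← hrange]
    rintro _ ⟨x, rfl⟩
    have hx := h.2 (.op (s x)) ⟨.op x, rfl⟩
    exact ⟨congrArg MulOpposite.unop hx.1, congrArg MulOpposite.unop hx.2⟩
  have idem (x : S) : p x * p x = p x := by simpa only [h4] using h1 (p x)
  have hmem (x : S) : s x ∈ Set.range p := ⟨s x, h5' x⟩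
  rw [hmu]
  refine ⟨⟨fun h q hq => (h.2.2 q hq).symm, fun h => ?_⟩,
    ⟨fun h => ⟨h.1, fun q hq _ => (h.2.2 q hq).2⟩, fun h => ⟨h.1, left h.1 h.2⟩⟩,
    ⟨fun h => ⟨h.2.1, fun q hq _ => (h.2.2 q hq).1⟩, fun h => ?_⟩⟩
  · have hp : p a = p b := by
      have ha : p a = p (b * s a) := by rw [← (h _ (hmem a)).2, h1']
      have hb : p b = p (a * s b) := by rw [(h _ (hmem b)).2, h1']
      refine eq_of_sandwich (idem a) (idem b) ?_ ?_
      · rw [ha, ← h3]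
      · rw [hb, ← h3]
    exact ⟨hp, left hp fun q hq _ => (h q hq).1⟩
  · obtain ⟨hp, hq⟩ := right h.1 h.2
    exact ⟨hp, h.1, fun q hm => (hq q hm).symm⟩
end

section
/- Let (P,×,⋆) be a projection algebra and p,q ∈ P with p ≤_P q. Then for all t ∈ P: (t⋆p)⋆q = t⋆p, (t⋆q)⋆p = t⋆p, q×(t⋆p) = t⋆p; and dually q×(p×t) = p×t, p×(q×t) = p×t, (p×t)⋆q = p×t. -/
/-- In a projection algebra, if `p ≤_P q` then for all `t`:
`(t⋆p)⋆q = t⋆p`, `(t⋆q)⋆p = t⋆p`, `q×(t⋆p) = t⋆p`, and dually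
`q×(p×t) = p×t`, `p×(q×t) = p×t`, `(p×t)⋆q = p×t`. -/
theorem stmt_12 (P : Type*) (times star : P → P → P)
    (L1 : ∀ e : P, times e e = e)
    (L2 : ∀ e f : P, times (times e f) e = times e f)
    (L3 : ∀ e f g : P, times e (times f g) = times (times e f) (times f g))
    (L4 : ∀ e f g : P, times (times e f) g = times (times e f) (times e g))
    (R1 : ∀ e : P, star e e = e)
    (R2 : ∀ e f : P, star f e = star e (star f e))
    (R3 : ∀ e f g : P, star (star g f) e = star (star g f) (star f e))
    (R4 : ∀ e f g : P, star g (star f e) = star (star g e) (star f e))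
    (P3a : ∀ e f g : P, star (star e (times f g)) g = star (star e f) g)
    (P3b : ∀ e f g : P, times g (times (star g f) e) = times g (times f e))
    (P4a : ∀ e f : P, star (times e f) e = times e f)
    (P4b : ∀ e f : P, times f (star e f) = star e f)
    (p q : P) (hpq : p = times q p) :
    ∀ t : P,
      star (star t p) q = star t p ∧
      star (star t q) p = star t p ∧
      times q (star t p) = star t p ∧
      times q (times p t) = times p t ∧
      times p (times q t) = times p t ∧
      star (times p t) q = times p t := by
  have star_p_q : star p q = p := by
    have h := P4a q p
    rwa [← hpq] at h
  have star_star (x : P) : star (star x p) p = star x p := by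
    have h := P4a p (star x p)
    rwa [P4b] at h
  have times_times (x : P) : times p (times p x) = times p x := by
    have h := P4b (times p x) p
    rwa [P4a] at h
  have times_q (x : P) : times q (times p x) = times p x := by
    rw [L3, ← hpq, times_times]
  intro t
  refine ⟨?_, ?_, ?_, times_q t, ?_, ?_⟩
  · rw [R3, star_p_q, star_star]
  · have h := P3a t q p
    rw [← hpq, star_star] at h
    exact h.symm
  · have h := times_q (star t p)
    rwa [P4b] at h
  · have h := P3b t q p
    rw [star_p_q, times_times] at h
    exact h.symm
  · have h := P4a q (times p t)
    rwa [times_q] at h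
end

section
/- Let (P,×,⋆) be a projection algebra, k ≥ 1, and p_1, p_2, …, p_k ∈ P with p_i F_P p_{i+1} for all 1 ≤ i < k. Then p_1 × (p_2 × (⋯ × (p_{k-1} × p_k)⋯)) = p_1 and (⋯((p_1 ⋆ p_2) ⋆ p_3)⋯) ⋆ p_k = p_k. -/
/-- `nestRight f pv n = pv 0 ⬝ (pv 1 ⬝ (⋯ ⬝ (pv (n-1) ⬝ pv n)⋯))`. -/
def nestRight {α : Type*} (f : α → α → α) : (ℕ → α) → ℕ → α
  | pv, 0 => pv 0
  | pv, n + 1 => f (pv 0) (nestRight f (fun i => pv (i + 1)) n)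

/-- `nestLeft f pv n = ((⋯(pv 0 ⬝ pv 1)⋯) ⬝ pv (n-1)) ⬝ pv n`. -/
def nestLeft {α : Type*} (f : α → α → α) (pv : ℕ → α) : ℕ → α
  | 0 => pv 0
  | n + 1 => f (nestLeft f pv n) (pv (n + 1))

theorem nestRight_eq_head {α : Type*} (f : α → α → α) (n : ℕ) (pv : ℕ → α)
    (h : ∀ i < n, f (pv i) (pv (i + 1)) = pv i) : nestRight f pv n = pv 0 := by
  induction n generalizing pv with
  | zero => rfl
  | succ n ih =>
    rw [nestRight, ih (fun i => pv (i + 1)) fun i hi => h (i + 1) (by omega)]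
    exact h 0 (by omega)

theorem nestLeft_eq_last {α : Type*} (f : α → α → α) (n : ℕ) (pv : ℕ → α)
    (h : ∀ i < n, f (pv i) (pv (i + 1)) = pv (i + 1)) : nestLeft f pv n = pv n := by
  induction n with
  | zero => rfl
  | succ n ih =>
    rw [nestLeft, ih fun i hi => h i (by omega)]
    exact h n (by omega)

/-- In a projection algebra, if `p_0 F_P p_1 F_P ⋯ F_P p_n` then
`p_0 × (p_1 × (⋯ × (p_{n-1} × p_n)⋯)) = p_0` and
`(⋯((p_0 ⋆ p_1) ⋆ p_2)⋯) ⋆ p_n = p_n`. -/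
theorem stmt_15 (P : Type*) (times star : P → P → P)
    (L1 : ∀ e : P, times e e = e)
    (L2 : ∀ e f : P, times (times e f) e = times e f)
    (L3 : ∀ e f g : P, times e (times f g) = times (times e f) (times f g))
    (L4 : ∀ e f g : P, times (times e f) g = times (times e f) (times e g))
    (R1 : ∀ e : P, star e e = e)
    (R2 : ∀ e f : P, star f e = star e (star f e))
    (R3 : ∀ e f g : P, star (star g f) e = star (star g f) (star f e))
    (R4 : ∀ e f g : P, star g (star f e) = star (star g e) (star f e))
    (P3a : ∀ e f g : P, star (star e (times f g)) g = star (star e f) g)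
    (P3b : ∀ e f g : P, times g (times (star g f) e) = times g (times f e))
    (P4a : ∀ e f : P, star (times e f) e = times e f)
    (P4b : ∀ e f : P, times f (star e f) = star e f)
    (n : ℕ) (pv : ℕ → P)
    (hchain : ∀ i < n, times (pv i) (pv (i + 1)) = pv i ∧
                       star (pv i) (pv (i + 1)) = pv (i + 1)) :
    nestRight times pv n = pv 0 ∧ nestLeft star pv n = pv n :=
  ⟨nestRight_eq_head times n pv fun i hi => (hchain i hi).1,
    nestLeft_eq_last star n pv fun i hi => (hchain i hi).2⟩
end

section
/- Let (P,×,⋆) be a strong projection algebra and p,s ∈ P. Then for all t ∈ P: (p⋆s)×t = (p×(s×t))⋆s, and dually t⋆(s×p) = s×((t⋆s)⋆p). -/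
/-- In a strong projection algebra, for all `p, s, t`:
`(p⋆s)×t = (p×(s×t))⋆s` and dually `t⋆(s×p) = s×((t⋆s)⋆p)`. -/
theorem stmt_16 (P : Type*) (times star : P → P → P)
    (L1 : ∀ e : P, times e e = e)
    (L2 : ∀ e f : P, times (times e f) e = times e f)
    (L3 : ∀ e f g : P, times e (times f g) = times (times e f) (times f g))
    (L4 : ∀ e f g : P, times (times e f) g = times (times e f) (times e g))
    (R1 : ∀ e : P, star e e = e)
    (R2 : ∀ e f : P, star f e = star e (star f e))
    (R3 : ∀ e f g : P, star (star g f) e = star (star g f) (star f e))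
    (R4 : ∀ e f g : P, star g (star f e) = star (star g e) (star f e))
    (P3a : ∀ e f g : P, star (star e (times f g)) g = star (star e f) g)
    (P3b : ∀ e f g : P, times g (times (star g f) e) = times g (times f e))
    (P4a : ∀ e f : P, star (times e f) e = times e f)
    (P4b : ∀ e f : P, times f (star e f) = star e f)
    (SP1 : ∀ e f g : P, times e (star (times (times e f) g) f) = times (times e f) g)
    (SP2 : ∀ e f g : P, star (times f (star g (star f e))) e = star g (star f e))
    (p s : P) :
    ∀ t : P,
      times (star p s) t = star (times p (times s t)) s ∧
      star t (times s p) = times s (star (star t s) p) := by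
  intro t
  constructor
  · have h := SP2 s p (times (star p s) t)
    rwa [P4a, P3b, eq_comm] at h
  · have h := SP1 s p (star t (times s p))
    rwa [P4b, P3a, eq_comm] at h
end

section
/- Let (P,×,⋆) be a strong projection algebra and let (e,p,f) be an admissible triple of P, i.e. f = (e⋆p)⋆f and e = e×(p×f). Then e F_P (e⋆p) and (e⋆p) F_P f, and also e F_P (p×f) and (p×f) F_P f. -/
/-- In a strong projection algebra, if `(e,p,f)` is an admissible triple
(`f = (e⋆p)⋆f` and `e = e×(p×f)`), then `e F_P (e⋆p)`, `(e⋆p) F_P f`,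
`e F_P (p×f)` and `(p×f) F_P f`. -/
theorem stmt_17 (P : Type*) (times star : P → P → P)
    (L1 : ∀ e : P, times e e = e)
    (L2 : ∀ e f : P, times (times e f) e = times e f)
    (L3 : ∀ e f g : P, times e (times f g) = times (times e f) (times f g))
    (L4 : ∀ e f g : P, times (times e f) g = times (times e f) (times e g))
    (R1 : ∀ e : P, star e e = e)
    (R2 : ∀ e f : P, star f e = star e (star f e))
    (R3 : ∀ e f g : P, star (star g f) e = star (star g f) (star f e))
    (R4 : ∀ e f g : P, star g (star f e) = star (star g e) (star f e))
    (P3a : ∀ e f g : P, star (star e (times f g)) g = star (star e f) g)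
    (P3b : ∀ e f g : P, times g (times (star g f) e) = times g (times f e))
    (P4a : ∀ e f : P, star (times e f) e = times e f)
    (P4b : ∀ e f : P, times f (star e f) = star e f)
    (SP1 : ∀ e f g : P, times e (star (times (times e f) g) f) = times (times e f) g)
    (SP2 : ∀ e f g : P, star (times f (star g (star f e))) e = star g (star f e))
    (e p f : P)
    (hadm1 : f = star (star e p) f)
    (hadm2 : e = times e (times p f)) :
    -- e F_P (e⋆p)
    (times e (star e p) = e ∧ star e (star e p) = star e p) ∧
    -- (e⋆p) F_P f
    (times (star e p) f = star e p ∧ star (star e p) f = f) ∧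
    -- e F_P (p×f)
    (times e (times p f) = e ∧ star e (times p f) = times p f) ∧
    -- (p×f) F_P f
    (times (times p f) f = times p f ∧ star (times p f) f = f) := by
  have times_absorb : ∀ a b : P, times a (times a b) = times a b := fun a b => by
    have h := L4 a a b
    rw [L1] at h
    exact h.symm
  have star_absorb : ∀ a b : P, star (star a b) b = star a b := fun a b => by
    have h := R4 b b a
    rw [R1] at h
    exact h.symm
  have he : times e (times (star e p) f) = e := by rw [P3b, ← hadm2]
  have hf : star (star e (times p f)) f = f := by rw [P3a, ← hadm1]
  have he' : times (times e (star e p)) (times (star e p) f) = e := by rw [← L3, he]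
  have hf' : star (star e (times p f)) (star (times p f) f) = f := by rw [← R3, hf]
  have times_left : times e (star e p) = e := by
    have h := times_absorb (times e (star e p)) (times (star e p) f)
    rwa [he', L2] at h
  have star_right : star (times p f) f = f := by
    have h := star_absorb (star e (times p f)) (star (times p f) f)
    rwa [hf', ← R2] at h
  have star_left : star e (star e p) = star e p := by rw [R4, R1]
  have times_right : times (times p f) f = times p f := by rw [L4, L1]
  have times_star : times (star e p) f = star e p := by
    have h := SP2 p e (times (star e p) f)
    rw [P4a, he] at h
    exact h.symm
  have star_times : star e (times p f) = times p f := by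
    have h := SP1 p f (star e (times p f))
    rw [P4b, hf] at h
    exact h.symm
  exact ⟨⟨times_left, star_left⟩, ⟨times_star, hadm1.symm⟩,
    ⟨hadm2.symm, star_times⟩, ⟨times_right, star_right⟩⟩
end

section
/- Let (P,×,⋆) be a strong projection algebra and p,q ∈ P with p F_P q. Then the map γ : {x ∈ P : x ≤_P p} → {y ∈ P : y ≤_P q}, x ↦ x⋆q, is a bijection with inverse y ↦ p×y (i.e. x⋆q ≤_P q for every x ≤_P p, p×y ≤_P p for every y ≤_P q, p×(x⋆q) = x for every x ≤_P p, and (p×y)⋆q = y for every y ≤_P q), and γ is a projection algebra isomorphism: (x×x′)⋆q = (x⋆q)×(x′⋆q) and (x⋆x′)⋆q = (x⋆q)⋆(x′⋆q) for all x,x′ ≤_P p. -/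
/-- In a strong projection algebra, if `p F_P q`, then `x ↦ x⋆q` is a bijection
from `{x : x ≤_P p}` to `{y : y ≤_P q}` with inverse `y ↦ p×y`, and it is a
projection algebra isomorphism. -/
theorem stmt_18 (P : Type*) (times star : P → P → P)
    (L1 : ∀ e : P, times e e = e)
    (L2 : ∀ e f : P, times (times e f) e = times e f)
    (L3 : ∀ e f g : P, times e (times f g) = times (times e f) (times f g))
    (L4 : ∀ e f g : P, times (times e f) g = times (times e f) (times e g))
    (R1 : ∀ e : P, star e e = e)
    (R2 : ∀ e f : P, star f e = star e (star f e))
    (R3 : ∀ e f g : P, star (star g f) e = star (star g f) (star f e))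
    (R4 : ∀ e f g : P, star g (star f e) = star (star g e) (star f e))
    (P3a : ∀ e f g : P, star (star e (times f g)) g = star (star e f) g)
    (P3b : ∀ e f g : P, times g (times (star g f) e) = times g (times f e))
    (P4a : ∀ e f : P, star (times e f) e = times e f)
    (P4b : ∀ e f : P, times f (star e f) = star e f)
    (SP1 : ∀ e f g : P, times e (star (times (times e f) g) f) = times (times e f) g)
    (SP2 : ∀ e f g : P, star (times f (star g (star f e))) e = star g (star f e))
    (p q : P) (hF1 : times p q = p) (hF2 : star p q = q) :
    -- x⋆q ≤_P q for x ≤_P p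
    (∀ x : P, x = times p x → star x q = times q (star x q)) ∧
    -- p×y ≤_P p for y ≤_P q
    (∀ y : P, y = times q y → times p y = times p (times p y)) ∧
    -- y ↦ p×y is a left inverse of x ↦ x⋆q
    (∀ x : P, x = times p x → times p (star x q) = x) ∧
    -- y ↦ p×y is a right inverse of x ↦ x⋆q
    (∀ y : P, y = times q y → star (times p y) q = y) ∧
    -- x ↦ x⋆q is a homomorphism of projection algebras
    (∀ x x' : P, x = times p x → x' = times p x' →
      star (times x x') q = times (star x q) (star x' q) ∧
      star (star x x') q = star (star x q) (star x' q)) := by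
  have left_inv : ∀ x : P, x = times p x → times p (star x q) = x := by
    intro x hx
    have h := SP1 p q x
    rwa [hF1, ← hx] at h
  have right_inv : ∀ y : P, y = times q y → star (times p y) q = y := by
    intro y hy
    have hyq : star y q = y := by
      rw [hy]
      exact P4a q y
    have h := SP2 q p y
    rwa [hF2, hyq] at h
  have le_times : ∀ a b c : P, b = times a b → times b c = times a (times b c) := by
    intro a b c hb
    have h := L4 b b c
    rw [L1] at h
    rw [L3 a b c, ← hb]
    exact h
  refine ⟨fun x _ => (P4b x q).symm, fun y _ => ?_, left_inv, right_inv, fun x x' hx hx' => ⟨?_, ?_⟩⟩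
  · have h := L4 p p y
    rwa [L1] at h
  · have hle : star x q = times q (star x q) := (P4b x q).symm
    have hx'q : times x (star x' q) = times x x' := by
      have h := L4 p x (star x' q)
      rwa [← hx, left_inv x' hx'] at h
    have hxq : times x (times (star x q) (star x' q)) = times x x' := by
      rw [P3b, P4b, hx'q]
    have hp : times p (times (star x q) (star x' q)) = times x x' := by
      rw [L3, left_inv x hx, hxq]
    rw [← hp]
    exact right_inv _ (le_times q _ _ hle)
  · have hx'q : times p (star x' q) = x' := left_inv x' hx'
    have hxp : star x p = x := by
      rw [hx]
      exact P4a p x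
    have h := P3a x p (star x' q)
    rw [hx'q, hxp] at h
    rw [R3, h, R4]
end

section
/- Let (P,×,⋆) be a strong projection algebra, let X_P⁺ be the free semigroup on the set P (with generators x_p for p ∈ P), and let ∼ be the semigroup congruence on X_P⁺ generated by the relations x_p x_p ∼ x_p, x_{p×q} x_q ∼ x_p x_q, x_{p×q} x_{p⋆q} ∼ x_p x_q, and x_p x_{p⋆q} ∼ x_p x_q for all p,q ∈ P. Then every word x_{q_1} x_{q_2} ⋯ x_{q_k} ∈ X_P⁺ (k ≥ 1) is ∼-equivalent to a word x_{p_1} x_{p_2} ⋯ x_{p_k} of the same length k with p_i F_P p_{i+1} for all 1 ≤ i < k. -/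
/-- The word `x_{q₀} x_{q₁} ⋯` in the free semigroup on `P` corresponding to a
head `q₀` and a tail list `qs`. -/
def projWord {P : Type*} (q0 : P) (qs : List P) : FreeSemigroup P :=
  qs.foldl (fun w q => w * FreeSemigroup.of q) (FreeSemigroup.of q0)

/-- The defining relations of the presentation: `x_p x_p = x_p`,
`x_{p×q} x_q = x_p x_q`, `x_{p×q} x_{p⋆q} = x_p x_q` and
`x_p x_{p⋆q} = x_p x_q`. -/
def projRel {P : Type*} (times star : P → P → P)
    (u v : FreeSemigroup P) : Prop :=
  (∃ p : P, u = FreeSemigroup.of p * FreeSemigroup.of p ∧ v = FreeSemigroup.of p) ∨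
  (∃ p q : P, u = FreeSemigroup.of (times p q) * FreeSemigroup.of q ∧
    v = FreeSemigroup.of p * FreeSemigroup.of q) ∨
  (∃ p q : P, u = FreeSemigroup.of (times p q) * FreeSemigroup.of (star p q) ∧
    v = FreeSemigroup.of p * FreeSemigroup.of q) ∨
  (∃ p q : P, u = FreeSemigroup.of p * FreeSemigroup.of (star p q) ∧
    v = FreeSemigroup.of p * FreeSemigroup.of q)

theorem projWord_cons {P : Type*} (p q : P) (qs : List P) :
    projWord p (q :: qs) = FreeSemigroup.of p * projWord q qs := by
  have foldl_mul (ps : List P) (u v : FreeSemigroup P) :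
      ps.foldl (fun w r => w * FreeSemigroup.of r) (u * v) =
        u * ps.foldl (fun w r => w * FreeSemigroup.of r) v := by
    induction ps generalizing v with
    | nil => rfl
    | cons r rs ih => simp only [List.foldl_cons, mul_assoc, ih]
  exact foldl_mul qs _ _

theorem conGen_projWord_cons_cons {P : Type*} {r : FreeSemigroup P → FreeSemigroup P → Prop}
    {p q p' q' : P}
    (h : r (FreeSemigroup.of p' * FreeSemigroup.of q') (FreeSemigroup.of p * FreeSemigroup.of q))
    (qs : List P) : conGen r (projWord p (q :: qs)) (projWord p' (q' :: qs)) := by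
  have head_mul (s t : P) : projWord s (t :: qs) = qs.foldl (fun w a => w * FreeSemigroup.of a)
      (FreeSemigroup.of s * FreeSemigroup.of t) := rfl
  rw [head_mul, head_mul]
  have foldl_congr (as : List P) {u v : FreeSemigroup P} (huv : conGen r u v) :
      conGen r (as.foldl (fun w a => w * FreeSemigroup.of a) u)
        (as.foldl (fun w a => w * FreeSemigroup.of a) v) := by
    induction as generalizing u v with
    | nil => exact huv
    | cons a as ih => exact ih ((conGen r).mul huv ((conGen r).refl _))
  exact foldl_congr qs ((conGen r).symm (ConGen.Rel.of _ _ h))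

/-- Lowering the first letter of an `F_P`-chain: the decrease propagates to the right, and the
lowered word is equivalent to an `F_P`-chain of the same length. -/
theorem exists_chain_of_head_le {P : Type*} {times star : P → P → P}
    (L1 : ∀ e : P, times e e = e)
    (L4 : ∀ e f g : P, times (times e f) g = times (times e f) (times e g))
    (R1 : ∀ e : P, star e e = e)
    (R4 : ∀ e f g : P, star g (star f e) = star (star g e) (star f e))
    (P4b : ∀ e f : P, times f (star e f) = star e f)
    (SP1 : ∀ e f g : P, times e (star (times (times e f) g) f) = times (times e f) g)
    {p p' : P} (ps : List P)
    (hps : List.IsChain (fun a b => times a b = a ∧ star a b = b) (p :: ps))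
    (hp : times p p' = p') :
    ∃ ps' : List P, ps'.length = ps.length ∧
      List.IsChain (fun a b => times a b = a ∧ star a b = b) (p' :: ps') ∧
      conGen (projRel times star) (projWord p' ps) (projWord p' ps') := by
  induction ps generalizing p p' with
  | nil => exact ⟨[], rfl, List.isChain_singleton _, Con.refl _ _⟩
  | cons q qs ih =>
    obtain ⟨⟨hpq, -⟩, hqs⟩ := List.isChain_cons_cons.mp hps
    obtain ⟨qs', hlen, hchain, hcon⟩ := ih hqs (P4b p' q)
    refine ⟨star p' q :: qs', by simp [hlen], List.isChain_cons_cons.mpr ⟨⟨?_, ?_⟩, hchain⟩, ?_⟩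
    · have hres : times p (star p' q) = p' := by
        have h := SP1 p q p'
        rwa [hpq, hp] at h
      have h := L4 p p' (star p' q)
      rwa [hp, hres, L1] at h
    · rw [R4, R1]
    · refine Con.trans _
        (conGen_projWord_cons_cons (Or.inr (Or.inr (Or.inr ⟨p', q, rfl, rfl⟩))) qs) ?_
      rw [projWord_cons, projWord_cons]
      exact Con.mul _ (Con.refl _ _) hcon

/-- In the free semigroup on a strong projection algebra `P`, modulo the
congruence generated by the relations `x_p x_p ∼ x_p`, `x_{p×q} x_q ∼ x_p x_q`,
`x_{p×q} x_{p⋆q} ∼ x_p x_q`, `x_p x_{p⋆q} ∼ x_p x_q`, every word is equivalent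
to a word of the same length whose consecutive letters are `F_P`-related. -/
theorem stmt_19 (P : Type*) (times star : P → P → P)
    (L1 : ∀ e : P, times e e = e)
    (L2 : ∀ e f : P, times (times e f) e = times e f)
    (L3 : ∀ e f g : P, times e (times f g) = times (times e f) (times f g))
    (L4 : ∀ e f g : P, times (times e f) g = times (times e f) (times e g))
    (R1 : ∀ e : P, star e e = e)
    (R2 : ∀ e f : P, star f e = star e (star f e))
    (R3 : ∀ e f g : P, star (star g f) e = star (star g f) (star f e))
    (R4 : ∀ e f g : P, star g (star f e) = star (star g e) (star f e))
    (P3a : ∀ e f g : P, star (star e (times f g)) g = star (star e f) g)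
    (P3b : ∀ e f g : P, times g (times (star g f) e) = times g (times f e))
    (P4a : ∀ e f : P, star (times e f) e = times e f)
    (P4b : ∀ e f : P, times f (star e f) = star e f)
    (SP1 : ∀ e f g : P, times e (star (times (times e f) g) f) = times (times e f) g)
    (SP2 : ∀ e f g : P, star (times f (star g (star f e))) e = star g (star f e)) :
    ∀ (q0 : P) (qs : List P), ∃ (p0 : P) (ps : List P),
      ps.length = qs.length ∧
      List.Chain' (fun a b => times a b = a ∧ star a b = b) (p0 :: ps) ∧
      conGen (projRel times star) (projWord q0 qs) (projWord p0 ps) := by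
  intro q0 qs
  induction qs generalizing q0 with
  | nil => exact ⟨q0, [], rfl, List.isChain_singleton _, Con.refl _ _⟩
  | cons q qs ih =>
    obtain ⟨p, ps, hlen, hchain, hcon⟩ := ih q
    obtain ⟨ps', hlen', hchain', hcon'⟩ :=
      exists_chain_of_head_le L1 L4 R1 R4 P4b SP1 ps hchain (P4b q0 p)
    have times_star : times q0 (star q0 p) = times q0 p := by
      have hle : times (star q0 p) p = star q0 p := by
        have h := L2 p (star q0 p)
        rwa [P4b] at h
      have h := P3b p p q0
      rwa [hle, L1] at h
    have star_times : star (times q0 p) p = star q0 p := by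
      have hle : star q0 (times q0 p) = times q0 p := by
        have h := R2 q0 (times q0 p)
        rw [P4a] at h
        exact h.symm
      have h := P3a q0 q0 p
      rwa [hle, R1] at h
    refine ⟨times q0 p, star q0 p :: ps', by simp [hlen, hlen'],
      List.isChain_cons_cons.mpr ⟨⟨?_, ?_⟩, hchain'⟩, ?_⟩
    · rw [L4, times_star, L1]
    · rw [R4, star_times, R1]
    · have hhead : conGen (projRel times star) (projWord q0 (q :: qs)) (projWord q0 (p :: ps)) := by
        rw [projWord_cons, projWord_cons]
        exact Con.mul _ (Con.refl _ _) hcon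
      refine hhead.trans (Con.trans _
        (conGen_projWord_cons_cons (Or.inr (Or.inr (Or.inl ⟨q0, p, rfl, rfl⟩))) ps) ?_)
      rw [projWord_cons, projWord_cons]
      exact Con.mul _ (Con.refl _ _) hcon'
end
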